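/- For every n ≥ 9, the universal Gröbner basis of I_{K_n} is strictly contained in the Graver basis of I_{K_n}: there exists a primitive binomial of I_{K_n} that does not belong to the universal Gröbner basis of I_{K_n}. -/

import Mathlib

open MvPolynomial

noncomputable section

/-! ### Term orders, initial terms, (reduced) Gröbner bases, universal Gröbner basis -/

/-- A term order on the monomials (exponent vectors) in variables indexed by `σ`:
a linear order for which `0` is least and which is compatible with addition. -/
structure TermOrder (σ : Type*) where
  lo : LinearOrder (σ →₀ ℕ)
  zero_min : ∀ u : σ →₀ ℕ, lo.le 0 u
  add_right : ∀ u v w : σ →₀ ℕ, lo.le u v → lo.le (u + w) (v + w)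

variable {σ : Type*} {K : Type*} [Field K]

/-- The leading (largest) exponent of a polynomial with respect to a term order
(junk value `0` if `f = 0`). -/
def TermOrder.leadExp (t : TermOrder σ) (f : MvPolynomial σ K) : σ →₀ ℕ :=
  haveI := Classical.propDecidable (f = 0)
  if h : f = 0 then 0
  else @Finset.max' _ t.lo f.support
    (Finset.nonempty_iff_ne_empty.mpr fun he => h (MvPolynomial.support_eq_empty.mp he))

/-- The initial term of a polynomial with respect to a term order. -/
def TermOrder.initial (t : TermOrder σ) (f : MvPolynomial σ K) : MvPolynomial σ K :=
  monomial (t.leadExp f) (f.coeff (t.leadExp f))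

/-- `𝒢` is a Gröbner basis of `I` w.r.t. the term order `t`. -/
def IsGroebnerBasis (t : TermOrder σ) (I : Ideal (MvPolynomial σ K))
    (𝒢 : Finset (MvPolynomial σ K)) : Prop :=
  (𝒢 : Set (MvPolynomial σ K)) ⊆ (I : Set (MvPolynomial σ K)) ∧
    Ideal.span (t.initial '' (𝒢 : Set (MvPolynomial σ K))) =
      Ideal.span (t.initial '' (I : Set (MvPolynomial σ K)))

/-- `𝒢` is a reduced Gröbner basis of `I` w.r.t. `t`: a Gröbner basis, all of whose elements
are monic, and no monomial occurring in an element of `𝒢` is divisible by the initial term of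
a different element of `𝒢`. -/
def IsReducedGroebnerBasis (t : TermOrder σ) (I : Ideal (MvPolynomial σ K))
    (𝒢 : Finset (MvPolynomial σ K)) : Prop :=
  IsGroebnerBasis t I 𝒢 ∧
    (∀ g ∈ 𝒢, g.coeff (t.leadExp g) = 1) ∧
    (∀ g ∈ 𝒢, ∀ g' ∈ 𝒢, g' ≠ g → ∀ u ∈ g.support, ¬ t.leadExp g' ≤ u)

/-- The universal Gröbner basis of `I`: the union of all reduced Gröbner bases of `I`
over all term orders. -/
def UniversalGB (I : Ideal (MvPolynomial σ K)) : Set (MvPolynomial σ K) :=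
  {f | ∃ (t : TermOrder σ) (𝒢 : Finset (MvPolynomial σ K)),
    IsReducedGroebnerBasis t I 𝒢 ∧ f ∈ 𝒢}

/-! ### Binomials, primitive binomials (Graver basis), circuits -/

/-- The binomial `x^u - x^v`. -/
def binom (K : Type*) [Field K] {σ : Type*} (u v : σ →₀ ℕ) : MvPolynomial σ K :=
  monomial u 1 - monomial v 1

/-- `f` is a primitive binomial of `I`: `f = x^u - x^v ∈ I` and there is no other binomial
`x^w - x^z ∈ I` with `x^w ∣ x^u` and `x^z ∣ x^v`.  The set of primitive binomials of `I`
is the Graver basis of `I`. -/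
def IsPrimitiveBinomial (I : Ideal (MvPolynomial σ K)) (f : MvPolynomial σ K) : Prop :=
  ∃ u v : σ →₀ ℕ, u ≠ v ∧ f = binom K u v ∧ f ∈ I ∧
    ∀ w z : σ →₀ ℕ, w ≠ z → binom K w z ∈ I → w ≤ u → z ≤ v → w = u ∧ z = v

/-- `f` is a circuit of `I`: an irreducible binomial of `I` whose support (set of variables
occurring in it) is minimal among the supports of nonzero binomials of `I`. -/
def IsCircuitBinomial (I : Ideal (MvPolynomial σ K)) (f : MvPolynomial σ K) : Prop :=
  (∃ u v : σ →₀ ℕ, u ≠ v ∧ f = binom K u v) ∧ f ∈ I ∧ Irreducible f ∧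
    ∀ g : MvPolynomial σ K, (∃ u v : σ →₀ ℕ, u ≠ v ∧ g = binom K u v) → g ∈ I →
      g.vars ⊆ f.vars → g.vars = f.vars

/-- The toric ideal of a vector configuration `A = (a_1, …, a_m) ⊆ ℕ^n`: the ideal generated
by all binomials `x^u - x^v` with `Σ uᵢ aᵢ = Σ vᵢ aᵢ`. -/
def toricIdealOfConfig (K : Type*) [Field K] {m n : ℕ} (A : Fin m → Fin n → ℕ) :
    Ideal (MvPolynomial (Fin m) K) :=
  Ideal.span {f | ∃ u v : Fin m →₀ ℕ,
    f = binom K u v ∧ (∑ i, u i • A i) = ∑ i, v i • A i}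

/-! ### Toric ideals of graphs -/

variable {V : Type*}

/-- The image `x_u * x_v` of an edge `e = {u, v}`. -/
def edgeImage (K : Type*) [Field K] {V : Type*} (e : Sym2 V) : MvPolynomial V K :=
  Sym2.lift ⟨fun a b => X a * X b, fun a b => mul_comm _ _⟩ e

/-- The toric ideal `I_G` of a graph `G`: the kernel of the `K`-algebra map
`K[e : e ∈ E(G)] → K[x_v : v ∈ V(G)]`, `e = {u,v} ↦ x_u x_v`. -/
def graphToricIdeal (K : Type*) [Field K] (G : SimpleGraph V) :
    Ideal (MvPolynomial G.edgeSet K) :=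
  RingHom.ker (MvPolynomial.aeval
    (fun e : G.edgeSet => edgeImage K (e : Sym2 V)) :
      MvPolynomial G.edgeSet K →ₐ[K] MvPolynomial V K).toRingHom

/-- An even closed walk `(v_0, v_1, …, v_{2q} = v_0)` in a graph `G`;
edges and vertices may repeat. -/
structure EvenClosedWalk (G : SimpleGraph V) where
  q : ℕ
  verts : ℕ → V
  adj : ∀ i, i < 2 * q → G.Adj (verts i) (verts (i + 1))
  closed : verts (2 * q) = verts 0

namespace EvenClosedWalk

variable {G : SimpleGraph V}

/-- The `i`-th edge of the walk, as an element of the edge set of `G`. -/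
def edge (w : EvenClosedWalk G) (i : ℕ) (h : i < 2 * w.q) : G.edgeSet :=
  ⟨s(w.verts i, w.verts (i + 1)), w.adj i h⟩

/-- The exponent vector `w⁺` of the monomial `E⁺(w)`, the product of the edges of `w`
in odd position (`1`-indexed). -/
def plusExp (w : EvenClosedWalk G) : G.edgeSet →₀ ℕ :=
  ∑ k : Fin w.q, Finsupp.single (w.edge (2 * (k : ℕ)) (by have := k.isLt; omega)) 1

/-- The exponent vector `w⁻` of the monomial `E⁻(w)`, the product of the edges of `w`
in even position (`1`-indexed). -/
def minusExp (w : EvenClosedWalk G) : G.edgeSet →₀ ℕ :=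
  ∑ k : Fin w.q, Finsupp.single (w.edge (2 * (k : ℕ) + 1) (by have := k.isLt; omega)) 1

end EvenClosedWalk

/-- The monomial `E⁺(w)`. -/
def Eplus (K : Type*) [Field K] {G : SimpleGraph V} (w : EvenClosedWalk G) :
    MvPolynomial G.edgeSet K :=
  monomial w.plusExp 1

/-- The monomial `E⁻(w)`. -/
def Eminus (K : Type*) [Field K] {G : SimpleGraph V} (w : EvenClosedWalk G) :
    MvPolynomial G.edgeSet K :=
  monomial w.minusExp 1

/-- The binomial `B_w = E⁺(w) - E⁻(w)` of an even closed walk. -/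
def Bw (K : Type*) [Field K] {G : SimpleGraph V} (w : EvenClosedWalk G) :
    MvPolynomial G.edgeSet K :=
  binom K w.plusExp w.minusExp

namespace EvenClosedWalk

variable {G : SimpleGraph V}

/-- The number of positions of the walk at which the edge `e` appears. -/
def count [DecidableEq V] (w : EvenClosedWalk G) (e : Sym2 V) : ℕ :=
  ((Finset.range (2 * w.q)).filter fun i => e = s(w.verts i, w.verts (i + 1))).card

/-- The subgraph `𝐰` of `G` spanned by the edges of the walk `w`. -/
def graph (w : EvenClosedWalk G) : SimpleGraph V :=
  SimpleGraph.fromEdgeSet {e | ∃ i, ∃ _ : i < 2 * w.q, e = s(w.verts i, w.verts (i + 1))}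

/-- The set `w⁺` of edges of `w` in odd position (`1`-indexed). -/
def plusEdges (w : EvenClosedWalk G) : Set (Sym2 V) :=
  {e | ∃ k, ∃ _ : k < w.q, e = s(w.verts (2 * k), w.verts (2 * k + 1))}

/-- The set `w⁻` of edges of `w` in even position (`1`-indexed). -/
def minusEdges (w : EvenClosedWalk G) : Set (Sym2 V) :=
  {e | ∃ k, ∃ _ : k < w.q, e = s(w.verts (2 * k + 1), w.verts (2 * k + 2))}

/-- An even closed walk is primitive if it is nontrivial and there is no even closed
subwalk `ξ` of smaller length with `E⁺(ξ) ∣ E⁺(w)` and `E⁻(ξ) ∣ E⁻(w)`. -/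
def IsPrimitive (w : EvenClosedWalk G) : Prop :=
  0 < w.q ∧ ∀ ξ : EvenClosedWalk G, 0 < ξ.q → ξ.q < w.q →
    ¬(ξ.plusExp ≤ w.plusExp ∧ ξ.minusExp ≤ w.minusExp)

/-- The walk `w` is a cycle: it visits no vertex twice. -/
def IsCycle (w : EvenClosedWalk G) : Prop :=
  2 ≤ w.q ∧ ∀ i j, i < 2 * w.q → j < 2 * w.q → w.verts i = w.verts j → i = j

end EvenClosedWalk

/-! ### Cut vertices, cut edges, blocks, sinks -/

/-- `v` is a cut vertex of `H`: removing `v` (and the edges through it) disconnects two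
vertices different from `v` that were connected in `H`. -/
def IsCutVertex (H : SimpleGraph V) (v : V) : Prop :=
  ∃ a b, a ≠ v ∧ b ≠ v ∧ H.Reachable a b ∧
    ¬(SimpleGraph.fromEdgeSet {e | e ∈ H.edgeSet ∧ v ∉ e}).Reachable a b

/-- `e` is a cut edge of `H`: removing it disconnects two vertices connected in `H`. -/
def IsCutEdge (H : SimpleGraph V) (e : Sym2 V) : Prop :=
  e ∈ H.edgeSet ∧ ∃ a b, H.Reachable a b ∧ ¬(H.deleteEdges {e}).Reachable a b

/-- `H` is biconnected: it has an edge, it is connected (on its support),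
and it has no cut vertex. -/
def IsBiconnected (H : SimpleGraph V) : Prop :=
  H.edgeSet.Nonempty ∧ (∀ a ∈ H.support, ∀ b ∈ H.support, H.Reachable a b) ∧
    ∀ v, ¬IsCutVertex H v

/-- `B` is a block of `H`: a maximal biconnected subgraph. -/
def IsBlock (H B : SimpleGraph V) : Prop :=
  B ≤ H ∧ IsBiconnected B ∧ ∀ B', B ≤ B' → B' ≤ H → IsBiconnected B' → B' = B

/-- A graph is a cycle (graph): its edge set is the edge set of a cycle of length `≥ 3`. -/
def IsCycleGraph (B : SimpleGraph V) : Prop :=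
  ∃ (n : ℕ) (f : ℕ → V), 3 ≤ n ∧
    (∀ i j, i < n → j < n → f i = f j → i = j) ∧
    B.edgeSet = {e | ∃ i, ∃ _ : i < n, e = s(f i, f ((i + 1) % n))}

/-- `v` is a sink of the block `B` of the walk `w`: a common vertex of two odd
(or two even) edges of the walk belonging to `B`. -/
def IsSinkOf {G : SimpleGraph V} (w : EvenClosedWalk G) (B : SimpleGraph V) (v : V) : Prop :=
  ∃ e₁ e₂ : Sym2 V, e₁ ≠ e₂ ∧ e₁ ∈ B.edgeSet ∧ e₂ ∈ B.edgeSet ∧ v ∈ e₁ ∧ v ∈ e₂ ∧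
    ((e₁ ∈ w.plusEdges ∧ e₂ ∈ w.plusEdges) ∨ (e₁ ∈ w.minusEdges ∧ e₂ ∈ w.minusEdges))

/-- `B` is a pure cyclic block of the walk `w`: a block of `𝐰` which is a cycle all of whose
edges lie in `w⁺`, or all in `w⁻`. -/
def IsPureCyclicBlock {G : SimpleGraph V} (w : EvenClosedWalk G) (B : SimpleGraph V) : Prop :=
  IsBlock w.graph B ∧ IsCycleGraph B ∧
    (B.edgeSet ⊆ w.plusEdges ∨ B.edgeSet ⊆ w.minusEdges)

/-- A primitive walk is mixed if it has no pure cyclic block. -/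
def EvenClosedWalk.IsMixed {G : SimpleGraph V} (w : EvenClosedWalk G) : Prop :=
  ∀ B : SimpleGraph V, ¬IsPureCyclicBlock w B


namespace TermOrder

theorem le_add_right_cancel (t : TermOrder σ) {u v w : σ →₀ ℕ}
    (h : t.lo.le (u + w) (v + w)) : t.lo.le u v := by
  rcases t.lo.le_total u v with huv | hvu
  · exact huv
  · have := t.lo.le_antisymm _ _ h (t.add_right v u w hvu)
    rw [add_right_cancel this]
    exact t.lo.le_refl v

theorem add_le_add (t : TermOrder σ) {u v u' v' : σ →₀ ℕ}
    (h : t.lo.le u v) (h' : t.lo.le u' v') : t.lo.le (u + u') (v + v') := by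
  refine t.lo.le_trans _ _ _ (t.add_right u v u' h) ?_
  rw [add_comm v, add_comm v]
  exact t.add_right u' v' v h'

theorem le_of_dvd (t : TermOrder σ) {u v : σ →₀ ℕ} (h : u ≤ v) : t.lo.le u v := by
  have := t.add_right 0 (v - u) u (t.zero_min _)
  rwa [zero_add, tsub_add_cancel_of_le h] at this

theorem leadExp_mem_support (t : TermOrder σ) {f : MvPolynomial σ K} (hf : f ≠ 0) :
    t.leadExp f ∈ f.support := by
  rw [leadExp, dif_neg hf]
  exact @Finset.max'_mem _ t.lo _ _

theorem le_leadExp (t : TermOrder σ) {f : MvPolynomial σ K} {u : σ →₀ ℕ}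
    (hu : u ∈ f.support) : t.lo.le u (t.leadExp f) := by
  have hf : f ≠ 0 := by
    rintro rfl
    simp at hu
  rw [leadExp, dif_neg hf]
  exact @Finset.le_max' _ t.lo _ _ hu

end TermOrder

theorem coeff_binom_left {u v : σ →₀ ℕ} (h : u ≠ v) : (binom K u v).coeff u = 1 := by
  classical
  simp [binom, coeff_monomial, h.symm]

theorem coeff_binom_right {u v : σ →₀ ℕ} (h : u ≠ v) : (binom K u v).coeff v = -1 := by
  classical
  simp [binom, coeff_monomial, h]

theorem left_mem_support_binom {u v : σ →₀ ℕ} (h : u ≠ v) : u ∈ (binom K u v).support := by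
  rw [mem_support_iff, coeff_binom_left h]
  exact one_ne_zero

theorem right_mem_support_binom {u v : σ →₀ ℕ} (h : u ≠ v) : v ∈ (binom K u v).support := by
  rw [mem_support_iff, coeff_binom_right h]
  exact neg_ne_zero.mpr one_ne_zero

theorem eq_or_eq_of_mem_support_binom {u v w : σ →₀ ℕ} (h : w ∈ (binom K u v).support) :
    w = u ∨ w = v := by
  classical
  by_contra! hw
  rw [mem_support_iff] at h
  exact h (by simp [binom, coeff_monomial, hw.1.symm, hw.2.symm])

theorem binom_ne_zero {u v : σ →₀ ℕ} (h : u ≠ v) : binom K u v ≠ 0 := by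
  intro h0
  have := left_mem_support_binom (K := K) h
  simp [h0] at this

theorem TermOrder.leadExp_binom (t : TermOrder σ) {u v : σ →₀ ℕ} (h : u ≠ v)
    (hvu : t.lo.le v u) : t.leadExp (binom K u v) = u := by
  rcases eq_or_eq_of_mem_support_binom (t.leadExp_mem_support (binom_ne_zero (K := K) h)) with
    hl | hl
  · exact hl
  · have := t.le_leadExp (left_mem_support_binom (K := K) h)
    rw [hl] at this
    exact absurd (t.lo.le_antisymm _ _ this hvu) h

/-! ### Initial terms and reduced Gröbner bases -/

namespace IsReducedGroebnerBasis

variable {t : TermOrder σ} {I : Ideal (MvPolynomial σ K)} {𝒢 : Finset (MvPolynomial σ K)}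

theorem ne_zero (h : IsReducedGroebnerBasis t I 𝒢) {g : MvPolynomial σ K} (hg : g ∈ 𝒢) :
    g ≠ 0 := by
  rintro rfl
  simpa using h.2.1 0 hg

theorem exists_leadExp_le (h : IsReducedGroebnerBasis t I 𝒢) {p : MvPolynomial σ K}
    (hp : p ∈ I) (hp0 : p ≠ 0) : ∃ g ∈ 𝒢, t.leadExp g ≤ t.leadExp p := by
  have hmem : t.initial p ∈ Ideal.span (t.initial '' (𝒢 : Set (MvPolynomial σ K))) := by
    rw [h.1.2]
    exact Ideal.subset_span ⟨p, hp, rfl⟩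
  have himage : t.initial '' (𝒢 : Set (MvPolynomial σ K)) =
      (fun s => monomial s (1 : K)) '' (t.leadExp '' (𝒢 : Set (MvPolynomial σ K))) := by
    rw [Set.image_image]
    refine Set.image_congr fun g hg => ?_
    rw [TermOrder.initial, h.2.1 g hg]
  rw [himage, mem_ideal_span_monomial_image] at hmem
  obtain ⟨_, ⟨g, hg, rfl⟩, hle⟩ := hmem (t.leadExp p) (by
    classical
    rw [mem_support_iff, TermOrder.initial, coeff_monomial, if_pos rfl]
    exact mem_support_iff.mp (t.leadExp_mem_support hp0))
  exact ⟨g, hg, hle⟩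

/-- The leading exponent of an element of a reduced Gröbner basis is minimal among the leading
exponents of the ideal. -/
theorem leadExp_eq_of_le (h : IsReducedGroebnerBasis t I 𝒢) {f p : MvPolynomial σ K}
    (hf : f ∈ 𝒢) (hp : p ∈ I) (hp0 : p ≠ 0) (hle : t.leadExp p ≤ t.leadExp f) :
    t.leadExp p = t.leadExp f := by
  obtain ⟨g, hg, hgp⟩ := h.exists_leadExp_le hp hp0
  by_cases hgf : g = f
  · subst hgf
    exact le_antisymm hle hgp
  · exact absurd (hgp.trans hle) (h.2.2 f hf g hg hgf _ (t.leadExp_mem_support (h.ne_zero hf)))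

/-- The non-leading monomials of an element of a reduced Gröbner basis are standard. -/
theorem not_leadExp_le (h : IsReducedGroebnerBasis t I 𝒢) {f p : MvPolynomial σ K}
    (hf : f ∈ 𝒢) (hp : p ∈ I) (hp0 : p ≠ 0) {v : σ →₀ ℕ} (hv : v ∈ f.support)
    (hvf : v ≠ t.leadExp f) : ¬ t.leadExp p ≤ v := by
  intro hle
  obtain ⟨g, hg, hgp⟩ := h.exists_leadExp_le hp hp0
  by_cases hgf : g = f
  · subst hgf
    exact hvf (t.lo.le_antisymm _ _ (t.le_leadExp hv) (t.le_of_dvd (hgp.trans hle)))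
  · exact h.2.2 f hf g hg hgf v hv (hgp.trans hle)

end IsReducedGroebnerBasis

/-! ### The vertex degree of a monomial -/

/-- The exponent vector of the image `x_u * x_v` of an edge `e = {u, v}`. -/
def edgeExp (e : Sym2 V) : V →₀ ℕ :=
  Sym2.lift ⟨fun a b => Finsupp.single a 1 + Finsupp.single b 1, fun _ _ => add_comm _ _⟩ e

theorem edgeImage_eq_monomial (e : Sym2 V) : edgeImage K e = monomial (edgeExp e) 1 := by
  induction e using Sym2.ind with
  | _ a b => simp [edgeImage, edgeExp, X, monomial_mul]

/-- The exponent vector of the image of a monomial in the edge variables. -/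
def vertexDegree (G : SimpleGraph V) : (G.edgeSet →₀ ℕ) →ₗ[ℕ] (V →₀ ℕ) :=
  Finsupp.linearCombination ℕ fun e : G.edgeSet => edgeExp (e : Sym2 V)

section ToricIdeal

variable {G : SimpleGraph V}

theorem aeval_edgeImage_monomial (u : G.edgeSet →₀ ℕ) (c : K) :
    aeval (fun e : G.edgeSet => edgeImage K (e : Sym2 V)) (monomial u c) =
      monomial (vertexDegree G u) c := by
  simp only [aeval_monomial, edgeImage_eq_monomial, monomial_pow, one_pow, vertexDegree,
    Finsupp.linearCombination_apply, algebraMap_eq]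
  rw [← mul_one c, ← C_mul_monomial, Finsupp.sum, monomial_sum_one, mul_one, Finsupp.prod]

theorem mem_graphToricIdeal {f : MvPolynomial G.edgeSet K} :
    f ∈ graphToricIdeal K G ↔
      aeval (fun e : G.edgeSet => edgeImage K (e : Sym2 V)) f = 0 := Iff.rfl

theorem binom_mem_graphToricIdeal {u v : G.edgeSet →₀ ℕ} :
    binom K u v ∈ graphToricIdeal K G ↔ vertexDegree G u = vertexDegree G v := by
  rw [mem_graphToricIdeal, binom, map_sub, aeval_edgeImage_monomial, aeval_edgeImage_monomial,
    sub_eq_zero, (monomial_left_injective (one_ne_zero' K)).eq_iff]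

theorem exists_ne_vertexDegree_eq {f : MvPolynomial G.edgeSet K} (hf : f ∈ graphToricIdeal K G)
    {u : G.edgeSet →₀ ℕ} (hu : u ∈ f.support) :
    ∃ v ∈ f.support, v ≠ u ∧ vertexDegree G v = vertexDegree G u := by
  classical
  by_contra! hne
  rw [mem_graphToricIdeal, f.as_sum, map_sum] at hf
  have hcoeff := congrArg (coeff (vertexDegree G u)) hf
  simp only [aeval_edgeImage_monomial, coeff_sum, coeff_monomial, coeff_zero] at hcoeff
  rw [Finset.sum_eq_single_of_mem u hu fun v hv hvu => if_neg (hne v hv hvu), if_pos rfl]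
    at hcoeff
  exact mem_support_iff.mp hu hcoeff

theorem IsReducedGroebnerBasis.exists_eq_binom {t : TermOrder G.edgeSet}
    {𝒢 : Finset (MvPolynomial G.edgeSet K)}
    (h : IsReducedGroebnerBasis t (graphToricIdeal K G) 𝒢) {f : MvPolynomial G.edgeSet K}
    (hf : f ∈ 𝒢) : ∃ v, v ≠ t.leadExp f ∧ f = binom K (t.leadExp f) v := by
  classical
  have hfI : f ∈ graphToricIdeal K G := h.1.1 hf
  have hu := t.leadExp_mem_support (h.ne_zero hf)
  obtain ⟨v, hv, hvu, hdeg⟩ := exists_ne_vertexDegree_eq hfI hu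
  refine ⟨v, hvu, ?_⟩
  by_contra hne
  have hd0 : f - binom K (t.leadExp f) v ≠ 0 := sub_ne_zero.mpr hne
  have hdI : f - binom K (t.leadExp f) v ∈ graphToricIdeal K G :=
    Ideal.sub_mem _ hfI (binom_mem_graphToricIdeal.mpr hdeg.symm)
  have hl := t.leadExp_mem_support hd0
  have hlu : t.leadExp (f - binom K (t.leadExp f) v) ≠ t.leadExp f := by
    intro he
    rw [he, mem_support_iff, coeff_sub, h.2.1 f hf, coeff_binom_left hvu.symm, sub_self] at hl
    exact hl rfl
  refine h.not_leadExp_le hf hdI hd0 ?_ hlu le_rfl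
  rcases Finset.mem_union.mp (support_sub _ _ _ hl) with hl' | hl'
  · exact hl'
  · rcases eq_or_eq_of_mem_support_binom hl' with he | he
    · rwa [he]
    · rwa [he]

theorem isPrimitiveBinomial_of_mem_universalGB {f : MvPolynomial G.edgeSet K}
    (hf : f ∈ UniversalGB (graphToricIdeal K G)) :
    IsPrimitiveBinomial (graphToricIdeal K G) f := by
  obtain ⟨t, 𝒢, h, hf⟩ := hf
  obtain ⟨v, hvu, hfb⟩ := h.exists_eq_binom hf
  have hfI : f ∈ graphToricIdeal K G := h.1.1 hf
  have hv : v ∈ f.support := by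
    rw [hfb]
    exact right_mem_support_binom hvu.symm
  have hdeg : vertexDegree G (t.leadExp f) = vertexDegree G v := by
    rw [hfb] at hfI
    exact binom_mem_graphToricIdeal.mp hfI
  refine ⟨t.leadExp f, v, hvu.symm, hfb, hfI, fun w z hwz hI hw hz => ?_⟩
  have standard : ∀ a b, a ≠ b → vertexDegree G a = vertexDegree G b → t.lo.le b a →
      ¬ a ≤ v := by
    intro a b hab hd hba hav
    refine h.not_leadExp_le hf (binom_mem_graphToricIdeal.mpr hd) (binom_ne_zero hab) hv hvu ?_
    rwa [t.leadExp_binom hab hba]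
  rw [binom_mem_graphToricIdeal] at hI
  rcases t.lo.le_total w z with hle | hle
  · exact absurd hz (standard z w hwz.symm hI.symm hle)
  · have hlead := t.leadExp_binom (K := K) hwz hle
    have hwu : w = t.leadExp f := by
      rw [← hlead]
      refine h.leadExp_eq_of_le hf (binom_mem_graphToricIdeal.mpr hI) (binom_ne_zero hwz) ?_
      rwa [hlead]
    refine ⟨hwu, ?_⟩
    by_contra hzv
    refine standard v z (Ne.symm hzv) ?_ (t.le_of_dvd hz) le_rfl
    rw [← hdeg, ← hwu, hI]

/-- A monomial with the same vertex degree as the leading monomial of an element of a reduced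
Gröbner basis, and not coprime to it, is not smaller. -/
theorem IsReducedGroebnerBasis.leadExp_le_of_common_factor {t : TermOrder G.edgeSet}
    {𝒢 : Finset (MvPolynomial G.edgeSet K)}
    (h : IsReducedGroebnerBasis t (graphToricIdeal K G) 𝒢) {f : MvPolynomial G.edgeSet K}
    (hf : f ∈ 𝒢) {d l l' p p' : G.edgeSet →₀ ℕ} (hd : d ≠ 0) (hf' : t.leadExp f = l)
    (hl : l = l' + d) (hp : p = p' + d) (hdeg : vertexDegree G l = vertexDegree G p) :
    t.lo.le l p := by
  subst hp hl
  refine t.add_right _ _ _ ?_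
  rcases t.lo.le_total l' p' with hle | hle
  · exact hle
  by_cases hlp : l' = p'
  · rw [hlp]
    exact t.lo.le_refl p'
  rw [map_add, map_add] at hdeg
  have hlead := t.leadExp_binom (K := K) hlp hle
  have := h.leadExp_eq_of_le hf (binom_mem_graphToricIdeal.mpr (add_right_cancel hdeg))
    (binom_ne_zero hlp) (by
      rw [hlead, hf']
      exact le_self_add)
  rw [hlead, hf'] at this
  exact absurd (left_eq_add.mp this) hd

end ToricIdeal

theorem exists_single_add_of_le {w v : σ →₀ ℕ} {e : σ} (h : w ≤ v + Finsupp.single e 1) :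
    ∃ c ≤ 1, ∃ w' ≤ v, w = w' + Finsupp.single e c := by
  classical
  refine ⟨min (w e) 1, min_le_right _ _, w - Finsupp.single e (min (w e) 1), ?_, ?_⟩
  · intro x
    have := h x
    simp only [Finsupp.coe_add, Pi.add_apply, Finsupp.coe_tsub, Pi.sub_apply,
      Finsupp.single_apply] at this ⊢
    split_ifs at this ⊢ with hx
    · subst hx
      omega
    · omega
  · rw [tsub_add_cancel_of_le]
    exact Finsupp.single_le_iff.mpr (min_le_left _ _)

/-! ### Three triangles attached to a triangle -/

section Triangles

/-- The edge of the complete graph joining two vertices of an embedded `Fin 9`. -/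
def embeddedEdge (x : Fin 9 ↪ V) (i j : Fin 9) (h : i ≠ j := by decide) :
    (⊤ : SimpleGraph V).edgeSet :=
  ⟨s(x i, x j), by simpa using h⟩

/-- The exponent vector of an edge joining two vertices of an embedded `Fin 9`. -/
def embeddedEdgeExp (x : Fin 9 ↪ V) (i j : Fin 9) (h : i ≠ j := by decide) :
    (⊤ : SimpleGraph V).edgeSet →₀ ℕ :=
  Finsupp.single (embeddedEdge x i j h) 1

variable (x : Fin 9 ↪ V)

theorem embeddedEdgeExp_ne_zero (i j : Fin 9) (h : i ≠ j) : embeddedEdgeExp x i j h ≠ 0 :=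
  Finsupp.single_ne_zero.mpr one_ne_zero

theorem vertexDegree_single_embeddedEdge (i j : Fin 9) (h : i ≠ j) (k : ℕ) :
    vertexDegree ⊤ (Finsupp.single (embeddedEdge x i j h) k) =
      Finsupp.single (x i) k + Finsupp.single (x j) k := by
  simp [vertexDegree, embeddedEdge, edgeExp]

theorem vertexDegree_embeddedEdgeExp (i j : Fin 9) (h : i ≠ j) :
    vertexDegree ⊤ (embeddedEdgeExp x i j h) =
      Finsupp.single (x i) 1 + Finsupp.single (x j) 1 :=
  vertexDegree_single_embeddedEdge x i j h 1

/-- The central triangle `0 1 2` together with the edges opposite to its vertices in the three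
attached triangles `0 3 4`, `1 5 6` and `2 7 8`. -/
def trianglesPlus : (⊤ : SimpleGraph V).edgeSet →₀ ℕ :=
  embeddedEdgeExp x 0 1 + embeddedEdgeExp x 1 2 + embeddedEdgeExp x 2 0 +
    embeddedEdgeExp x 3 4 + embeddedEdgeExp x 5 6 + embeddedEdgeExp x 7 8

/-- The edges joining the central triangle `0 1 2` to the other vertices of the three attached
triangles `0 3 4`, `1 5 6` and `2 7 8`. -/
def trianglesMinus : (⊤ : SimpleGraph V).edgeSet →₀ ℕ :=
  embeddedEdgeExp x 0 3 + embeddedEdgeExp x 0 4 + embeddedEdgeExp x 1 5 +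
    embeddedEdgeExp x 1 6 + embeddedEdgeExp x 2 7 + embeddedEdgeExp x 2 8

theorem vertexDegree_trianglesPlus :
    vertexDegree ⊤ (trianglesPlus x) = vertexDegree ⊤ (trianglesMinus x) := by
  simp only [trianglesPlus, trianglesMinus, map_add, vertexDegree_embeddedEdgeExp]
  abel

theorem trianglesPlus_ne_trianglesMinus : trianglesPlus x ≠ trianglesMinus x := by
  classical
  intro h
  have := DFunLike.congr_fun h (embeddedEdge x 3 4)
  simp [trianglesPlus, trianglesMinus, embeddedEdgeExp, embeddedEdge] at this

theorem eq_triangles_of_le {w z : (⊤ : SimpleGraph V).edgeSet →₀ ℕ} (hwz : w ≠ z)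
    (hdeg : vertexDegree ⊤ w = vertexDegree ⊤ z) (hw : w ≤ trianglesPlus x)
    (hz : z ≤ trianglesMinus x) : w = trianglesPlus x ∧ z = trianglesMinus x := by
  classical
  obtain ⟨w₆, hw₆, w₅', hw₅', rfl⟩ := exists_single_add_of_le hw
  obtain ⟨w₅, hw₅, w₄', hw₄', rfl⟩ := exists_single_add_of_le hw₅'
  obtain ⟨w₄, hw₄, w₃', hw₃', rfl⟩ := exists_single_add_of_le hw₄'
  obtain ⟨w₃, hw₃, w₂', hw₂', rfl⟩ := exists_single_add_of_le hw₃'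
  obtain ⟨w₂, hw₂, w₁', hw₁', rfl⟩ := exists_single_add_of_le hw₂'
  obtain ⟨w₁, hw₁, w₀', hw₀', rfl⟩ := exists_single_add_of_le (hw₁'.trans (zero_add _).ge)
  obtain rfl := nonpos_iff_eq_zero.mp hw₀'
  obtain ⟨z₆, hz₆, z₅', hz₅', rfl⟩ := exists_single_add_of_le hz
  obtain ⟨z₅, hz₅, z₄', hz₄', rfl⟩ := exists_single_add_of_le hz₅'
  obtain ⟨z₄, hz₄, z₃', hz₃', rfl⟩ := exists_single_add_of_le hz₄'
  obtain ⟨z₃, hz₃, z₂', hz₂', rfl⟩ := exists_single_add_of_le hz₃'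
  obtain ⟨z₂, hz₂, z₁', hz₁', rfl⟩ := exists_single_add_of_le hz₂'
  obtain ⟨z₁, hz₁, z₀', hz₀', rfl⟩ := exists_single_add_of_le (hz₁'.trans (zero_add _).ge)
  obtain rfl := nonpos_iff_eq_zero.mp hz₀'
  simp only [map_add, zero_add, vertexDegree_single_embeddedEdge] at hdeg
  have hdeg' := fun i => DFunLike.congr_fun hdeg (x i)
  simp only [Finsupp.coe_add, Pi.add_apply, Finsupp.single_apply,
    EmbeddingLike.apply_eq_iff_eq] at hdeg'
  have h₀ := hdeg' 0
  have h₁ := hdeg' 1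
  have h₂ := hdeg' 2
  have h₃ := hdeg' 3
  have h₄ := hdeg' 4
  have h₅ := hdeg' 5
  have h₆ := hdeg' 6
  have h₇ := hdeg' 7
  have h₈ := hdeg' 8
  simp at h₀ h₁ h₂ h₃ h₄ h₅ h₆ h₇ h₈
  obtain h | h : w₁ = 0 ∨ w₁ = 1 := by omega
  · refine absurd ?_ hwz
    obtain ⟨rfl, rfl, rfl, rfl, rfl⟩ : w₂ = 0 ∧ w₃ = 0 ∧ w₄ = 0 ∧ w₅ = 0 ∧ w₆ = 0 := by omega
    obtain ⟨rfl, rfl, rfl, rfl, rfl, rfl⟩ :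
        z₁ = 0 ∧ z₂ = 0 ∧ z₃ = 0 ∧ z₄ = 0 ∧ z₅ = 0 ∧ z₆ = 0 := by omega
    simp [h]
  · obtain ⟨rfl, rfl, rfl, rfl, rfl⟩ : w₂ = 1 ∧ w₃ = 1 ∧ w₄ = 1 ∧ w₅ = 1 ∧ w₆ = 1 := by omega
    obtain ⟨rfl, rfl, rfl, rfl, rfl, rfl⟩ :
        z₁ = 1 ∧ z₂ = 1 ∧ z₃ = 1 ∧ z₄ = 1 ∧ z₅ = 1 ∧ z₆ = 1 := by omega
    simp [h, trianglesPlus, trianglesMinus, embeddedEdgeExp]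

theorem isPrimitiveBinomial_triangles :
    IsPrimitiveBinomial (graphToricIdeal K ⊤)
      (binom K (trianglesPlus x) (trianglesMinus x)) :=
  ⟨_, _, trianglesPlus_ne_trianglesMinus x, rfl,
    binom_mem_graphToricIdeal.mpr (vertexDegree_trianglesPlus x),
    fun _ _ hwz hI hw hz =>
      eq_triangles_of_le x hwz (binom_mem_graphToricIdeal.mp hI) hw hz⟩

theorem binom_triangles_notMem_universalGB :
    binom K (trianglesPlus x) (trianglesMinus x) ∉ UniversalGB (graphToricIdeal K ⊤) := by
  rintro ⟨t, 𝒢, h, hf⟩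
  have hne := trianglesPlus_ne_trianglesMinus x
  have hl := t.leadExp_mem_support (h.ne_zero hf)
  have hdeg := vertexDegree_trianglesPlus x
  set p₀ := embeddedEdgeExp x 0 1 + embeddedEdgeExp x 0 1 + embeddedEdgeExp x 3 4 +
    embeddedEdgeExp x 5 6 + embeddedEdgeExp x 2 7 + embeddedEdgeExp x 2 8 with hp₀
  set p₁ := embeddedEdgeExp x 1 2 + embeddedEdgeExp x 1 2 + embeddedEdgeExp x 5 6 +
    embeddedEdgeExp x 7 8 + embeddedEdgeExp x 0 3 + embeddedEdgeExp x 0 4 with hp₁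
  set p₂ := embeddedEdgeExp x 2 0 + embeddedEdgeExp x 2 0 + embeddedEdgeExp x 7 8 +
    embeddedEdgeExp x 3 4 + embeddedEdgeExp x 1 5 + embeddedEdgeExp x 1 6 with hp₂
  have hdeg₀ : vertexDegree ⊤ (trianglesPlus x) = vertexDegree ⊤ p₀ := by
    simp only [hp₀, trianglesPlus, map_add, vertexDegree_embeddedEdgeExp]
    abel
  have hdeg₁ : vertexDegree ⊤ (trianglesPlus x) = vertexDegree ⊤ p₁ := by
    simp only [hp₁, trianglesPlus, map_add, vertexDegree_embeddedEdgeExp]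
    abel
  have hdeg₂ : vertexDegree ⊤ (trianglesPlus x) = vertexDegree ⊤ p₂ := by
    simp only [hp₂, trianglesPlus, map_add, vertexDegree_embeddedEdgeExp]
    abel
  have hsum : p₀ + p₁ + p₂ = trianglesPlus x + trianglesPlus x + trianglesMinus x := by
    simp only [hp₀, hp₁, hp₂, trianglesPlus, trianglesMinus]
    abel
  rcases eq_or_eq_of_mem_support_binom hl with hlead | hlead
  · have hle := t.le_leadExp (right_mem_support_binom (K := K) hne)
    rw [hlead] at hle
    refine hne (t.lo.le_antisymm _ _ ?_ hle)
    have := t.add_le_add (t.add_le_add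
      (h.leadExp_le_of_common_factor hf (embeddedEdgeExp_ne_zero x 3 4 (by decide)) hlead
        (l' := embeddedEdgeExp x 0 1 + embeddedEdgeExp x 1 2 + embeddedEdgeExp x 2 0 +
          embeddedEdgeExp x 5 6 + embeddedEdgeExp x 7 8) (by rw [trianglesPlus]; abel)
        (p' := embeddedEdgeExp x 0 1 + embeddedEdgeExp x 0 1 + embeddedEdgeExp x 5 6 +
          embeddedEdgeExp x 2 7 + embeddedEdgeExp x 2 8) (by rw [hp₀]; abel) hdeg₀)
      (h.leadExp_le_of_common_factor hf (embeddedEdgeExp_ne_zero x 5 6 (by decide)) hlead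
        (l' := embeddedEdgeExp x 0 1 + embeddedEdgeExp x 1 2 + embeddedEdgeExp x 2 0 +
          embeddedEdgeExp x 3 4 + embeddedEdgeExp x 7 8) (by rw [trianglesPlus]; abel)
        (p' := embeddedEdgeExp x 1 2 + embeddedEdgeExp x 1 2 + embeddedEdgeExp x 7 8 +
          embeddedEdgeExp x 0 3 + embeddedEdgeExp x 0 4) (by rw [hp₁]; abel) hdeg₁))
      (h.leadExp_le_of_common_factor hf (embeddedEdgeExp_ne_zero x 7 8 (by decide)) hlead
        (l' := embeddedEdgeExp x 0 1 + embeddedEdgeExp x 1 2 + embeddedEdgeExp x 2 0 +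
          embeddedEdgeExp x 3 4 + embeddedEdgeExp x 5 6) (by rw [trianglesPlus])
        (p' := embeddedEdgeExp x 2 0 + embeddedEdgeExp x 2 0 + embeddedEdgeExp x 3 4 +
          embeddedEdgeExp x 1 5 + embeddedEdgeExp x 1 6) (by rw [hp₂]; abel) hdeg₂)
    rw [hsum, add_comm _ (trianglesPlus x), add_comm _ (trianglesMinus x)] at this
    exact t.le_add_right_cancel this
  · have hle := t.le_leadExp (left_mem_support_binom (K := K) hne)
    rw [hlead] at hle
    refine hne (t.lo.le_antisymm _ _ hle ?_)
    have := t.add_le_add (t.add_le_add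
      (h.leadExp_le_of_common_factor hf (embeddedEdgeExp_ne_zero x 2 7 (by decide)) hlead
        (l' := embeddedEdgeExp x 0 3 + embeddedEdgeExp x 0 4 + embeddedEdgeExp x 1 5 +
          embeddedEdgeExp x 1 6 + embeddedEdgeExp x 2 8) (by rw [trianglesMinus]; abel)
        (p' := embeddedEdgeExp x 0 1 + embeddedEdgeExp x 0 1 + embeddedEdgeExp x 3 4 +
          embeddedEdgeExp x 5 6 + embeddedEdgeExp x 2 8) (by rw [hp₀]; abel)
        (hdeg.symm.trans hdeg₀))
      (h.leadExp_le_of_common_factor hf (embeddedEdgeExp_ne_zero x 0 3 (by decide)) hlead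
        (l' := embeddedEdgeExp x 0 4 + embeddedEdgeExp x 1 5 + embeddedEdgeExp x 1 6 +
          embeddedEdgeExp x 2 7 + embeddedEdgeExp x 2 8) (by rw [trianglesMinus]; abel)
        (p' := embeddedEdgeExp x 1 2 + embeddedEdgeExp x 1 2 + embeddedEdgeExp x 5 6 +
          embeddedEdgeExp x 7 8 + embeddedEdgeExp x 0 4) (by rw [hp₁]; abel)
        (hdeg.symm.trans hdeg₁)))
      (h.leadExp_le_of_common_factor hf (embeddedEdgeExp_ne_zero x 1 5 (by decide)) hlead
        (l' := embeddedEdgeExp x 0 3 + embeddedEdgeExp x 0 4 + embeddedEdgeExp x 1 6 +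
          embeddedEdgeExp x 2 7 + embeddedEdgeExp x 2 8) (by rw [trianglesMinus]; abel)
        (p' := embeddedEdgeExp x 2 0 + embeddedEdgeExp x 2 0 + embeddedEdgeExp x 7 8 +
          embeddedEdgeExp x 3 4 + embeddedEdgeExp x 1 6) (by rw [hp₂]; abel)
        (hdeg.symm.trans hdeg₂))
    have h2 := t.le_add_right_cancel (hsum ▸ this)
    exact t.le_add_right_cancel (t.lo.le_trans _ _ _ h2 (add_comm (trianglesMinus x)
      (trianglesPlus x) ▸ t.add_right _ _ (trianglesPlus x) hle))

end Triangles

/-- For `n ≥ 9` the universal Gröbner basis of `I_{K_n}` is strictly contained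
in the Graver basis: every element of the universal Gröbner basis is a primitive binomial, and
there is a primitive binomial of `I_{K_n}` not in the universal Gröbner basis. -/
theorem universalGB_ssubset_Graver_of_completeGraph (K : Type*) [Field K] (n : ℕ)
    (hn : 9 ≤ n) :
    (∀ f, f ∈ UniversalGB (graphToricIdeal K (⊤ : SimpleGraph (Fin n))) →
        IsPrimitiveBinomial (graphToricIdeal K (⊤ : SimpleGraph (Fin n))) f) ∧
    ∃ f, IsPrimitiveBinomial (graphToricIdeal K (⊤ : SimpleGraph (Fin n))) f ∧
        f ∉ UniversalGB (graphToricIdeal K (⊤ : SimpleGraph (Fin n))) := by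
  refine ⟨fun f hf => isPrimitiveBinomial_of_mem_universalGB hf, ?_⟩
  exact ⟨_, isPrimitiveBinomial_triangles (Fin.castLEEmb hn),
    binom_triangles_notMem_universalGB (Fin.castLEEmb hn)⟩

end
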